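/- Let r ≥ 1, γ ∈ ℝ, and let q ∈ ℝ^r have nonzero coordinates with q₁²,…,q_r² pairwise distinct. For 0 ≤ k ≤ r let E_k = e_k(q₁²,…,q_r²) be the degree-k elementary symmetric polynomial of the squared coordinates (E_k = 0 for k < 0). Then for 1 ≤ k ≤ r: (i) −∑_{j=1}^r ( ∑_{l≠j} 2q_j/(q_j² − q_l²) + γ/q_j − q_j ) ∂E_k/∂q_j = 2k E_k + 2(r−k+1)(k−r−γ) E_{k−1}, and (ii) ∑_{j=1}^r ∂²E_k/∂q_j² = 2(r−k+1) E_{k−1}. (In operator form: Â S_k = 2k S_k + 2(r−k+1)(k−r−γ) S_{k−1} and Δ S_k = 2(r−k+1) S_{k−1} for the B_r Calogero system.) -/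

import Mathlib

/-- Partial derivative `∂f/∂q_j` of a function on `ℝ^r`. -/
noncomputable def pd {r : ℕ} (f : (Fin r → ℝ) → ℝ) (j : Fin r) (q : Fin r → ℝ) : ℝ :=
  fderiv ℝ f q (Pi.single j 1)

/-- The degree-`k` elementary symmetric polynomial of `q₁,…,q_n`. -/
noncomputable def esym {n : ℕ} (k : ℕ) (q : Fin n → ℝ) : ℝ :=
  ∑ t ∈ Finset.univ.powersetCard k, ∏ i ∈ t, q i

open Finset

/-- The degree-`k` elementary symmetric polynomial in the variables `x i` with `i ∈ s`. -/
noncomputable def esymOn {ι : Type*} (s : Finset ι) (k : ℕ) (x : ι → ℝ) : ℝ :=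
  ∑ t ∈ s.powersetCard k, ∏ i ∈ t, x i

section EsymOn

variable {ι : Type*} [DecidableEq ι] {s : Finset ι}

theorem esymOn_succ_eq_erase {j : ι} (hj : j ∈ s) (k : ℕ) (x : ι → ℝ) :
    esymOn s (k + 1) x = esymOn (s.erase j) (k + 1) x + x j * esymOn (s.erase j) k x := by
  have hn : j ∉ s.erase j := notMem_erase j s
  have hmem : ∀ t ∈ (s.erase j).powersetCard k, j ∉ t := fun t ht h =>
    hn ((mem_powersetCard.1 ht).1 h)
  unfold esymOn
  conv_lhs => rw [← insert_erase hj, powersetCard_succ_insert hn]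
  rw [sum_union, sum_image, mul_sum]
  · congr 1
    exact sum_congr rfl fun t ht => prod_insert (hmem t ht)
  · intro t ht u hu h
    rw [← erase_insert (hmem t ht), ← erase_insert (hmem u hu), h]
  · rw [disjoint_left]
    intro t ht hu
    obtain ⟨u, -, rfl⟩ := mem_image.1 hu
    exact hn ((mem_powersetCard.1 ht).1 (mem_insert_self j u))

theorem sum_esymOn_erase (s : Finset ι) (k : ℕ) (x : ι → ℝ) :
    ∑ j ∈ s, esymOn (s.erase j) k x = ((#s : ℝ) - k) * esymOn s k x := by
  unfold esymOn
  rw [sum_comm' (t' := s.powersetCard k) (s' := fun t => s \ t), mul_sum]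
  · refine sum_congr rfl fun t ht => ?_
    obtain ⟨hts, rfl⟩ := mem_powersetCard.1 ht
    rw [sum_const, nsmul_eq_mul, cast_card_sdiff hts]
  · intro j t
    simp only [mem_powersetCard, subset_erase, mem_sdiff]
    tauto

theorem sum_mul_esymOn_erase (s : Finset ι) (k : ℕ) (x : ι → ℝ) :
    ∑ j ∈ s, x j * esymOn (s.erase j) k x = ((k : ℝ) + 1) * esymOn s (k + 1) x := by
  have h : ∑ j ∈ s, esymOn s (k + 1) x =
      ∑ j ∈ s, (esymOn (s.erase j) (k + 1) x + x j * esymOn (s.erase j) k x) :=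
    sum_congr rfl fun j hj => esymOn_succ_eq_erase hj k x
  rw [sum_const, nsmul_eq_mul, sum_add_distrib, sum_esymOn_erase] at h
  push_cast at h
  linarith

theorem mul_esymOn_erase_sub {j l : ι} (hj : j ∈ s) (hl : l ∈ s) (hjl : j ≠ l) (k : ℕ)
    (x : ι → ℝ) :
    x j * esymOn (s.erase j) k x - x l * esymOn (s.erase l) k x =
      (x j - x l) * esymOn ((s.erase j).erase l) k x := by
  cases k with
  | zero => simp [esymOn]
  | succ k =>
    rw [esymOn_succ_eq_erase (mem_erase.2 ⟨hjl.symm, hl⟩),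
      esymOn_succ_eq_erase (mem_erase.2 ⟨hjl, hj⟩), erase_right_comm]
    ring

theorem sum_sum_div_sub_mul_esymOn_erase (s : Finset ι) (k : ℕ) {x : ι → ℝ}
    (hx : Set.InjOn x s) :
    2 * ∑ j ∈ s, ∑ l ∈ s.erase j, x j / (x j - x l) * esymOn (s.erase j) k x =
      ((#s : ℝ) - k) * ((#s : ℝ) - k - 1) * esymOn s k x := by
  have hswap : ∑ j ∈ s, ∑ l ∈ s.erase j, x j / (x j - x l) * esymOn (s.erase j) k x =
      ∑ j ∈ s, ∑ l ∈ s.erase j, x l / (x l - x j) * esymOn (s.erase l) k x :=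
    sum_comm' fun j l => by simp only [mem_erase]; tauto
  have hpair : ∀ j ∈ s, ∀ l ∈ s.erase j,
      x j / (x j - x l) * esymOn (s.erase j) k x + x l / (x l - x j) * esymOn (s.erase l) k x =
        esymOn ((s.erase j).erase l) k x := by
    intro j hj l hl
    obtain ⟨hlj, hl⟩ := mem_erase.1 hl
    have hne : x j - x l ≠ 0 := sub_ne_zero.2 fun h => hlj (hx hj hl h).symm
    rw [← neg_sub (x j) (x l), div_neg, neg_mul, ← sub_eq_add_neg, div_mul_eq_mul_div,
      div_mul_eq_mul_div, ← sub_div, mul_esymOn_erase_sub hj hl hlj.symm,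
      mul_div_cancel_left₀ _ hne]
  rw [two_mul]
  nth_rewrite 2 [hswap]
  simp_rw [← sum_add_distrib]
  rw [sum_congr rfl fun j hj => sum_congr rfl (hpair j hj)]
  simp_rw [sum_esymOn_erase]
  rw [sum_congr rfl fun j hj => by rw [cast_card_erase_of_mem hj], ← mul_sum, sum_esymOn_erase]
  ring

theorem esymOn_sq_update {j : ι} (hj : j ∉ s) (k : ℕ) (p : ι → ℝ) (t : ℝ) :
    esymOn s k (fun i => Function.update p j t i ^ 2) = esymOn s k fun i => p i ^ 2 := by
  refine sum_congr rfl fun u hu => prod_congr rfl fun i hi => ?_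
  have hij : i ≠ j := fun h => hj (h ▸ (mem_powersetCard.1 hu).1 hi)
  simp only [Function.update_of_ne hij]

end EsymOn

section PartialDerivatives

variable {r : ℕ}

theorem differentiable_esymOn_sq (s : Finset (Fin r)) (k : ℕ) :
    Differentiable ℝ fun p : Fin r → ℝ => esymOn s k fun i => p i ^ 2 := by
  unfold esymOn
  fun_prop

theorem pd_eq_of_hasDerivAt_update {f : (Fin r → ℝ) → ℝ} {q : Fin r → ℝ} {j : Fin r} {d : ℝ}
    (hf : DifferentiableAt ℝ f q)
    (hd : HasDerivAt (fun t => f (Function.update q j t)) d (q j)) : pd f j q = d := by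
  have hf' : HasFDerivAt f (fderiv ℝ f q) (Function.update q j (q j)) := by
    rw [Function.update_eq_self]
    exact hf.hasFDerivAt
  exact (hf'.comp_hasDerivAt (q j) (hasDerivAt_update q j (q j))).unique hd

theorem pd_esym_sq (k : ℕ) (j : Fin r) :
    pd (fun p => esym (k + 1) fun i => p i ^ 2) j =
      fun p => 2 * p j * esymOn (univ.erase j) k fun i => p i ^ 2 := by
  funext p
  refine pd_eq_of_hasDerivAt_update (differentiable_esymOn_sq univ (k + 1) p) ?_
  have h : (fun t => esym (k + 1) fun i => Function.update p j t i ^ 2) = fun t =>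
      esymOn (univ.erase j) (k + 1) (fun i => p i ^ 2) +
        t ^ 2 * esymOn (univ.erase j) k fun i => p i ^ 2 := by
    funext t
    refine (esymOn_succ_eq_erase (mem_univ j) k _).trans ?_
    rw [esymOn_sq_update (notMem_erase j _), esymOn_sq_update (notMem_erase j _),
      Function.update_self]
  rw [h]
  simpa using (((hasDerivAt_id (p j)).pow 2).mul_const
    (esymOn (univ.erase j) k fun i => p i ^ 2)).const_add
      (esymOn (univ.erase j) (k + 1) fun i => p i ^ 2)

theorem pd_pd_esym_sq (k : ℕ) (j : Fin r) (q : Fin r → ℝ) :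
    pd (pd (fun p => esym (k + 1) fun i => p i ^ 2) j) j q =
      2 * esymOn (univ.erase j) k fun i => q i ^ 2 := by
  rw [pd_esym_sq]
  have hdiff := differentiable_esymOn_sq (univ.erase j) k
  refine pd_eq_of_hasDerivAt_update (by fun_prop) ?_
  simp only [esymOn_sq_update (notMem_erase j _), Function.update_self]
  simpa using ((hasDerivAt_id (q j)).const_mul 2).mul_const
    (esymOn (univ.erase j) k fun i => q i ^ 2)

end PartialDerivatives

/-- Action of the reduced `B_r` Calogero operator and the Laplacian on the elementary
symmetric polynomials `S_k({q_j²})`: `Â S_k = 2k S_k + 2(r−k+1)(k−r−γ) S_{k−1}` and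
`Δ S_k = 2(r−k+1) S_{k−1}`. -/
theorem B_series_a_and_laplacian_on_esym (r : ℕ) (hr : 1 ≤ r) (γ : ℝ)
    (q : Fin r → ℝ) (hq0 : ∀ j, q j ≠ 0)
    (hqd : Function.Injective fun j => (q j)^2)
    (k : ℕ) (hk1 : 1 ≤ k) (hk2 : k ≤ r) :
    (-(∑ j, (∑ l ∈ Finset.univ.erase j, 2 * q j / ((q j)^2 - (q l)^2) + γ / q j - q j) *
          pd (fun p => esym k (fun i => (p i)^2)) j q)
      = 2 * (k : ℝ) * esym k (fun i => (q i)^2)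
        + 2 * ((r : ℝ) - k + 1) * ((k : ℝ) - r - γ) * esym (k - 1) (fun i => (q i)^2))
    ∧ (∑ j, pd (pd (fun p => esym k (fun i => (p i)^2)) j) j q
      = 2 * ((r : ℝ) - k + 1) * esym (k - 1) (fun i => (q i)^2)) := by
  obtain ⟨m, rfl⟩ : ∃ m, k = m + 1 := ⟨k - 1, by omega⟩
  set x : Fin r → ℝ := fun i => q i ^ 2 with hx
  have hE : ∀ n, esym n x = esymOn univ n x := fun _ => rfl
  have hsum := sum_esymOn_erase univ m x
  have hmul := sum_mul_esymOn_erase univ m x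
  have hdiv := sum_sum_div_sub_mul_esymOn_erase univ m hqd.injOn
  rw [card_univ, Fintype.card_fin] at hsum hdiv
  rw [Nat.add_sub_cancel, hE, hE]
  push_cast
  constructor
  · have hterm : ∀ j, (∑ l ∈ univ.erase j, 2 * q j / (q j ^ 2 - q l ^ 2) + γ / q j - q j) *
          pd (fun p => esym (m + 1) fun i => p i ^ 2) j q =
        4 * ∑ l ∈ univ.erase j, x j / (x j - x l) * esymOn (univ.erase j) m x +
          2 * γ * esymOn (univ.erase j) m x - 2 * (x j * esymOn (univ.erase j) m x) := by
      intro j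
      have hcancel : γ / q j * q j = γ := div_mul_cancel₀ γ (hq0 j)
      have hpull : ∑ l ∈ univ.erase j, x j / (x j - x l) * esymOn (univ.erase j) m x =
          (∑ l ∈ univ.erase j, 2 * q j / (q j ^ 2 - q l ^ 2)) *
            (q j / 2 * esymOn (univ.erase j) m x) := by
        rw [sum_mul]
        refine sum_congr rfl fun l _ => ?_
        simp only [hx]
        ring
      rw [pd_esym_sq, hpull]
      simp only [hx]
      linear_combination 2 * esymOn (univ.erase j) m (fun i => q i ^ 2) * hcancel
    rw [sum_congr rfl fun j _ => hterm j, sum_sub_distrib, sum_add_distrib, ← mul_sum, ← mul_sum,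
      ← mul_sum]
    linear_combination -2 * hdiv - 2 * γ * hsum + 2 * hmul
  · rw [sum_congr rfl fun j _ => pd_pd_esym_sq m j q, ← mul_sum]
    linear_combination 2 * hsum
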